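/- arXiv:2008.10331 — 5 statements merged into one kernel-verified Lean document; each statement's English description precedes it below -/
import Mathlib

section
/- Let f be a polynomial in ℝ[x₁,…,xₙ] and let x ∈ H(f). Then x is an isolated point of H(f) if and only if the connected component of x in H(f) (with the subspace topology induced from ℝⁿ) is the singleton {x}. -/
open MvPolynomial Metric

theorem aux_fiber_bound (n : ℕ) (F : Fin n → MvPolynomial (Fin n) ℝ) :
    ∃ M : ℕ, ∃ c : MvPolynomial (Fin n) ℝ, c ≠ 0 ∧ ∀ (S : Finset (Fin n → ℝ)) (e : Fin n → ℝ),
      eval e c ≠ 0 → (∀ s ∈ S, ∀ i, eval s (F i) = e i) → S.card ≤ M := by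
  classical
  have key : ∀ i : Fin n, ∃ Q : Polynomial (MvPolynomial (Fin n) ℝ), Q ≠ 0 ∧
      ∀ (s e : Fin n → ℝ), (∀ j, eval s (F j) = e j) →
        Polynomial.eval (s i) (Polynomial.map (eval e) Q) = 0 := by
    intro i
    let fam : Option (Fin n) → MvPolynomial (Fin n) ℝ := fun o => Option.elim o (X i) F
    have hnot : ¬ AlgebraicIndependent ℝ fam := by
      intro h
      have h1 := h.cardinalMk_le_trdeg
      rw [MvPolynomial.trdeg_of_isDomain] at h1
      simp at h1
    rw [algebraicIndependent_iff] at hnot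
    push Not at hnot
    obtain ⟨P, hP, hP0⟩ := hnot
    refine ⟨optionEquivLeft ℝ (Fin n) P, ?_, ?_⟩
    · intro h
      exact hP0 ((map_eq_zero_iff _ (optionEquivLeft ℝ (Fin n)).injective).1 h)
    · intro s e hs
      rw [← optionEquivLeft_elim_eval]
      have h2 : eval s (aeval fam P) = 0 := by rw [hP]; simp
      have h3 : eval s (aeval fam P) = eval (fun o => eval s (fam o)) P := by
        clear hP hP0 h2
        induction P using MvPolynomial.induction_on with
        | C a => simp
        | add p q hp hq => rw [map_add, map_add, map_add, hp, hq]
        | mul_X p j hp => rw [map_mul, map_mul, map_mul, hp, aeval_X, eval_X]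
      rw [h3] at h2
      rw [← h2]
      congr 2
      ext o
      cases o <;> simp [fam, hs]
  choose Q hQ0 hQ using key
  refine ⟨∏ i, (Q i).natDegree, ∏ i, (Q i).leadingCoeff, ?_, ?_⟩
  · rw [Finset.prod_ne_zero_iff]
    intro i _
    simpa using hQ0 i
  · intro S e he hS
    rw [map_prod, Finset.prod_ne_zero_iff] at he
    have hne : ∀ i, Polynomial.map (eval e) (Q i) ≠ 0 := by
      intro i h
      apply he i (Finset.mem_univ _)
      have := congrArg (fun p => Polynomial.coeff p (Q i).natDegree) h
      simpa [Polynomial.coeff_map] using this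
    have hsub : S ⊆ Fintype.piFinset
        (fun i => (Polynomial.map (eval e) (Q i)).roots.toFinset) := by
      intro s hs
      rw [Fintype.mem_piFinset]
      intro i
      rw [Multiset.mem_toFinset, Polynomial.mem_roots (hne i)]
      exact hQ i s e (hS s hs)
    refine (Finset.card_le_card hsub).trans ?_
    rw [Fintype.card_piFinset]
    refine Finset.prod_le_prod' fun i _ => ?_
    exact (Multiset.toFinset_card_le _).trans
      ((Polynomial.card_roots' _).trans Polynomial.natDegree_map_le)

theorem aux_hasDerivAt {n : ℕ} (p : MvPolynomial (Fin n) ℝ) (y : Fin n → ℝ) (i : Fin n) (t : ℝ) :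
    HasDerivAt (fun s => eval (Function.update y i s) p)
      (eval (Function.update y i t) (pderiv i p)) t := by
  induction p using MvPolynomial.induction_on with
  | C a => simpa using hasDerivAt_const t a
  | add p q hp hq => simp only [map_add]; exact hp.add hq
  | mul_X p j hp =>
    have hX : HasDerivAt (fun s => eval (Function.update y i s) (X j : MvPolynomial (Fin n) ℝ))
      (eval (Function.update y i t) (pderiv i (X j))) t := by
      by_cases h : j = i
      · subst h
        simpa using hasDerivAt_id' t
      · simpa [Function.update_of_ne h, pderiv_X_of_ne h] using hasDerivAt_const t (y j)
    have := hp.mul hX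
    simp only [Derivation.leibniz, map_mul, map_add, smul_eq_mul]
    convert! this using 1
    ring

theorem aux_continuous {n : ℕ} (p : MvPolynomial (Fin n) ℝ) :
    Continuous (fun y : Fin n → ℝ => eval y p) := MvPolynomial.continuous_eval p

theorem aux_crit {n : ℕ} (g : MvPolynomial (Fin n) ℝ)
    (V : Set (Fin n → ℝ)) (hV : IsOpen V) (hb : Bornology.IsBounded V) (z : Fin n → ℝ)
    (hz : z ∈ V) (hgz : eval z g = 0) (hfr : ∀ y ∈ frontier V, 0 < eval y g) :
    ∃ δ > 0, ∀ e : Fin n → ℝ, ‖e‖ < δ → ∃ y ∈ V, ∀ i, eval y (pderiv i g) = e i := by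
  have hc : IsCompact (closure V) := hb.isCompact_closure
  have hfc : IsCompact (frontier V) := hc.of_isClosed_subset isClosed_frontier frontier_subset_closure
  obtain ⟨m, hm, hmf⟩ : ∃ m > 0, ∀ y ∈ frontier V, m ≤ eval y g := by
    rcases (frontier V).eq_empty_or_nonempty with h | h
    · exact ⟨1, one_pos, by simp [h]⟩
    · obtain ⟨w, hw, hmin⟩ := hfc.exists_isMinOn h (aux_continuous g).continuousOn
      exact ⟨_, hfr w hw, fun y hy => hmin hy⟩
  obtain ⟨D, hD⟩ := hc.isBounded.subset_closedBall z
  have hD0 : 0 ≤ D := by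
    have := hD (subset_closure hz)
    simpa using this
  have hpos : 0 < n * D + 1 := by positivity
  refine ⟨m / (n * D + 1), by positivity, fun e he => ?_⟩
  rw [lt_div_iff₀ hpos] at he
  set q : MvPolynomial (Fin n) ℝ := g - ∑ j, C (e j) * X j with hq
  have hqe : ∀ y, eval y q = eval y g - ∑ j, e j * y j := by intro y; simp [hq]
  obtain ⟨y, hy, hmin⟩ := hc.exists_isMinOn ⟨z, subset_closure hz⟩ (aux_continuous q).continuousOn
  have hyV : y ∈ V := by
    by_contra hcon
    have hyf : y ∈ frontier V := by
      rw [hV.frontier_eq]; exact ⟨hy, hcon⟩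
    have h1 := hmf y hyf
    have h2 : eval y q ≤ eval z q := hmin (subset_closure hz)
    rw [hqe, hqe, hgz] at h2
    have h3 : ∑ j, e j * y j - ∑ j, e j * z j ≤ n * (‖e‖ * D) := by
      rw [← Finset.sum_sub_distrib]
      calc ∑ j, (e j * y j - e j * z j) ≤ ∑ _j : Fin n, ‖e‖ * D := by
            refine Finset.sum_le_sum fun j _ => ?_
            have a1 : |e j| ≤ ‖e‖ := norm_le_pi_norm e j
            have a2 : |y j - z j| ≤ D := by
              have := hD hy
              rw [mem_closedBall, dist_eq_norm] at this
              exact (norm_le_pi_norm (y - z) j).trans this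
            calc e j * y j - e j * z j = e j * (y j - z j) := by ring
              _ ≤ |e j * (y j - z j)| := le_abs_self _
              _ = |e j| * |y j - z j| := abs_mul _ _
              _ ≤ ‖e‖ * D := by gcongr
        _ = n * (‖e‖ * D) := by simp
    have h4 := norm_nonneg e
    nlinarith
  refine ⟨y, hyV, fun i => ?_⟩
  have hloc : IsLocalMin (fun w => eval w q) y :=
    hmin.isLocalMin (Filter.mem_of_superset (hV.mem_nhds hyV) subset_closure)
  have hloc2 : IsLocalMin (fun s => eval (Function.update y i s) q) (y i) := by
    have hct : Filter.Tendsto (fun s => Function.update y i s) (nhds (y i)) (nhds y) := by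
      have : Continuous (fun s => Function.update y i s) := by fun_prop
      have h := this.tendsto (y i)
      simpa using h
    have := hct.eventually hloc
    simpa [IsLocalMin, IsMinFilter] using this
  have h0 := hloc2.hasDerivAt_eq_zero (aux_hasDerivAt q y i (y i))
  rw [Function.update_eq_self] at h0
  have : pderiv i q = pderiv i g - C (e i) := by
    rw [hq, map_sub, map_sum]
    congr 1
    rw [Finset.sum_eq_single i]
    · simp
    · intro j _ hj
      simp [pderiv_X_of_ne hj]
    · simp
  rw [this] at h0
  simp at h0
  linarith

theorem aux_clopen {E : Type*} [MetricSpace E] [ProperSpace E] (H : Set E) (hH : IsClosed H)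
    (x : E) (hx : x ∈ H) (hcc : connectedComponentIn H x = {x}) (r : ℝ) (hr : 0 < r) :
    ∃ U : Set E, IsOpen U ∧ x ∈ U ∧ U ⊆ ball x r ∧ ∀ y ∈ frontier U, y ∉ H := by
  set K : Set E := H ∩ closedBall x (r / 2) with hK
  have hKc : IsCompact K := (isCompact_closedBall x (r / 2)).inter_left hH
  have hxK : x ∈ K := ⟨hx, mem_closedBall_self (by positivity)⟩
  haveI : CompactSpace K := isCompact_iff_compactSpace.1 hKc
  let x' : K := ⟨x, hxK⟩
  have hcc' : connectedComponent x' = {x'} := by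
    apply Set.Subset.antisymm
    · intro y hy
      have h1 : (y : E) ∈ connectedComponentIn K x := by
        rw [connectedComponentIn_eq_image hxK]
        exact ⟨y, hy, rfl⟩
      have h2 := connectedComponentIn_mono x (Set.inter_subset_left : K ⊆ H) h1
      rw [hcc] at h2
      exact Subtype.ext h2
    · simpa using mem_connectedComponent
  rw [connectedComponent_eq_iInter_isClopen] at hcc'
  let W : Set K := Subtype.val ⁻¹' ball x (r / 2)
  have hW : IsOpen W := isOpen_ball.preimage continuous_subtype_val
  have hxW : x' ∈ W := mem_ball_self (by positivity)
  obtain ⟨Z, hZ, hxZ, hZW⟩ : ∃ Z : Set K, IsClopen Z ∧ x' ∈ Z ∧ Z ⊆ W := by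
    let N := { s : Set K // IsClopen s ∧ x' ∈ s }
    rsuffices ⟨⟨s, hs, hs'⟩, hs''⟩ : ∃ s : N, s.val ⊆ W
    · exact ⟨s, hs, hs', hs''⟩
    have : Nonempty N := ⟨⟨Set.univ, isClopen_univ, Set.mem_univ x'⟩⟩
    have hNcl : ∀ s : N, IsClosed s.val := fun s => s.property.1.1
    have hdir : Directed GE.ge fun s : N => s.val := by
      rintro ⟨s, hs, hxs⟩ ⟨t, ht, hxt⟩
      exact ⟨⟨s ∩ t, hs.inter ht, ⟨hxs, hxt⟩⟩, Set.inter_subset_left, Set.inter_subset_right⟩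
    refine exists_subset_nhds_of_compactSpace hdir hNcl fun y y_in => ?_
    rw [hcc', Set.mem_singleton_iff] at y_in
    rw [y_in]
    exact hW.mem_nhds hxW
  have hA : IsCompact (Subtype.val '' Z : Set E) :=
    hZ.1.isCompact.image continuous_subtype_val
  have hB : IsCompact (Subtype.val '' Zᶜ : Set E) :=
    hZ.compl.1.isCompact.image continuous_subtype_val
  have hAB : Disjoint (Subtype.val '' Z : Set E) (Subtype.val '' Zᶜ) :=
    (Set.disjoint_image_iff Subtype.val_injective).2 disjoint_compl_right
  obtain ⟨A, B, hAo, hBo, hZA, hZB, hdis⟩ := SeparatedNhds.of_isCompact_isCompact hA hB hAB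
  refine ⟨A ∩ ball x (r / 2), hAo.inter isOpen_ball, ⟨hZA ⟨x', hxZ, rfl⟩, hxW⟩, ?_, ?_⟩
  · exact Set.inter_subset_right.trans (ball_subset_ball (by linarith))
  · intro y hy hyH
    rw [(hAo.inter isOpen_ball).frontier_eq] at hy
    obtain ⟨hyc, hyn⟩ := hy
    have hy1 : y ∈ closedBall x (r / 2) :=
      closure_ball_subset_closedBall (closure_mono Set.inter_subset_right hyc)
    have hy2 : y ∈ closure A := closure_mono Set.inter_subset_left hyc
    have hyK : y ∈ K := ⟨hyH, hy1⟩
    have hyB : y ∉ B := fun h => (hdis.closure_left hBo).le_bot ⟨hy2, h⟩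
    have hyZ : (⟨y, hyK⟩ : K) ∈ Z := by
      by_contra h
      exact hyB (hZB ⟨⟨y, hyK⟩, h, rfl⟩)
    exact hyn ⟨hZA ⟨_, hyZ, rfl⟩, hZW hyZ⟩

theorem aux_annulus {E : Type*} [MetricSpace E] [ProperSpace E] (H : Set E) (hH : IsClosed H)
    (x : E) (hx : x ∈ H) (hcc : connectedComponentIn H x = {x})
    (hni : ∀ U : Set E, IsOpen U → x ∈ U → ∃ z ∈ U, z ∈ H ∧ z ≠ x) (r : ℝ) (hr : 0 < r) :
    ∃ (V : Set E) (s : ℝ) (z : E), IsOpen V ∧ 0 < s ∧ s ≤ r ∧ V ⊆ ball x r ∧ Disjoint V (ball x s) ∧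
      z ∈ V ∧ z ∈ H ∧ ∀ y ∈ frontier V, y ∉ H := by
  obtain ⟨U, hU, hxU, hUr, hUf⟩ := aux_clopen H hH x hx hcc r hr
  obtain ⟨z, hzU, hzH, hzx⟩ := hni U hU hxU
  have hd : 0 < dist z x := dist_pos.2 hzx
  obtain ⟨U2, hU2, hxU2, hUr2, hUf2⟩ := aux_clopen H hH x hx hcc (dist z x / 2) (by positivity)
  obtain ⟨s, hs, hsU⟩ := Metric.isOpen_iff.1 hU2 x hxU2
  refine ⟨U \ closure U2, min s r, z, hU.sdiff isClosed_closure, lt_min hs hr, min_le_right _ _,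
    Set.diff_subset.trans hUr, ?_, ⟨hzU, ?_⟩, hzH, ?_⟩
  · rw [Set.disjoint_left]
    intro y hy hy2
    exact hy.2 (subset_closure (hsU (ball_subset_ball (min_le_left _ _) hy2)))
  · intro h
    have := closure_ball_subset_closedBall (closure_mono hUr2 h)
    rw [mem_closedBall] at this
    linarith
  · intro y hy hyH
    rw [(hU.sdiff isClosed_closure).frontier_eq] at hy
    obtain ⟨hyc, hyn⟩ := hy
    have hyU : y ∈ U := by
      by_contra h
      refine hUf y ?_ hyH
      rw [hU.frontier_eq]
      exact ⟨closure_mono Set.diff_subset hyc, h⟩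
    have hy2 : y ∈ closure U2 := by
      by_contra h
      exact hyn ⟨hyU, h⟩
    have hy3 : y ∈ U2 := by
      by_contra h
      refine hUf2 y ?_ hyH
      rw [hU2.frontier_eq]
      exact ⟨hy2, h⟩
    have hdj : Disjoint (U \ closure U2) U2 :=
      Set.disjoint_left.2 fun w hw hw2 => hw.2 (subset_closure hw2)
    exact (hdj.closure_left hU2).le_bot ⟨hyc, hy3⟩

theorem aux_many {n : ℕ} (f : MvPolynomial (Fin n) ℝ) (H : Set (Fin n → ℝ))
    (hH : H = {y | eval y f = 0}) (x : Fin n → ℝ) (hx : x ∈ H)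
    (hcc : connectedComponentIn H x = {x})
    (hni : ∀ U : Set (Fin n → ℝ), IsOpen U → x ∈ U → ∃ z ∈ U, z ∈ H ∧ z ≠ x) (N : ℕ) :
    ∀ r > 0, ∃ δ > 0, ∀ e : Fin n → ℝ, ‖e‖ < δ → ∃ S : Finset (Fin n → ℝ), S.card = N ∧
      ∀ y ∈ S, y ∈ ball x r ∧ ∀ i, eval y (pderiv i (f ^ 2)) = e i := by
  classical
  have hHc : IsClosed H := by
    rw [hH]; exact isClosed_eq (aux_continuous f) continuous_const
  induction N with
  | zero => exact fun r hr => ⟨1, one_pos, fun e _ => ⟨∅, by simp⟩⟩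
  | succ N ih =>
    intro r hr
    obtain ⟨V, s, z, hV, hs, hsr, hVr, hVs, hzV, hzH, hfr⟩ :=
      aux_annulus H hHc x hx hcc hni r hr
    obtain ⟨δ1, hδ1, h1⟩ := ih s hs
    obtain ⟨δ2, hδ2, h2⟩ := aux_crit (f ^ 2) V hV (isBounded_ball.subset hVr) z hzV
      (by rw [hH] at hzH; simpa using hzH)
      (by
        intro y hy
        have h := hfr y hy
        rw [hH, Set.mem_setOf_eq] at h
        rw [map_pow]
        positivity)
    refine ⟨min δ1 δ2, lt_min hδ1 hδ2, fun e he => ?_⟩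
    obtain ⟨S, hS, hSy⟩ := h1 e (he.trans_le (min_le_left _ _))
    obtain ⟨y, hy, hye⟩ := h2 e (he.trans_le (min_le_right _ _))
    have hyS : y ∉ S := fun h => hVs.le_bot ⟨hy, (hSy y h).1⟩
    refine ⟨insert y S, by rw [Finset.card_insert_of_notMem hyS, hS], fun w hw => ?_⟩
    rcases Finset.mem_insert.1 hw with rfl | hw
    · exact ⟨hVr hy, hye⟩
    · exact ⟨ball_subset_ball hsr (hSy w hw).1, (hSy w hw).2⟩

theorem aux_main {n : ℕ} (f : MvPolynomial (Fin n) ℝ) (H : Set (Fin n → ℝ))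
    (hH : H = {y | eval y f = 0}) (x : Fin n → ℝ) (hx : x ∈ H)
    (hcc : connectedComponentIn H x = {x}) :
    ∃ U : Set (Fin n → ℝ), IsOpen U ∧ x ∈ U ∧ ∀ z ∈ U, z ∈ H → z = x := by
  by_contra hcon
  push Not at hcon
  obtain ⟨M, c, hc, hM⟩ := aux_fiber_bound n (fun i => pderiv i (f ^ 2))
  obtain ⟨δ, hδ, h⟩ := aux_many f H hH x hx hcc hcon (M + 1) 1 one_pos
  apply hc
  refine funext_set (fun _ => ball (0 : ℝ) δ) (fun _ => ?_) fun e he => ?_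
  · rw [Real.ball_eq_Ioo]
    exact Set.Ioo_infinite (by linarith)
  · rw [map_zero]
    by_contra hne
    have hen : ‖e‖ < δ := by
      rw [pi_norm_lt_iff hδ]
      intro i
      simpa using he i trivial
    obtain ⟨S, hS, hSy⟩ := h e hen
    have := hM S e hne fun s hs => (hSy s hs).2
    omega

/-- A point `x` of the real zero set `H(f)` of a polynomial
`f ∈ ℝ[x₁,…,xₙ]` is isolated (some open Euclidean ball around `x` meets `H(f)`
only in `x`) if and only if the connected component of `x` in `H(f)` (with the
subspace topology) is the singleton `{x}`. -/
theorem isolated_iff_connectedComponentIn_singleton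
    (n : ℕ) (hn : 1 ≤ n) (f : MvPolynomial (Fin n) ℝ)
    (H : Set (EuclideanSpace ℝ (Fin n)))
    (hH : H = {y : EuclideanSpace ℝ (Fin n) | MvPolynomial.eval y f = 0})
    (x : EuclideanSpace ℝ (Fin n)) (hx : x ∈ H) :
    (∃ r > 0, Metric.ball x r ∩ H = {x}) ↔ connectedComponentIn H x = {x} := by
  constructor
  · rintro ⟨r, hr, hb⟩
    apply Set.Subset.antisymm
    · intro y hy
      by_contra hyx
      obtain ⟨w, hw, hw1, hw2⟩ := isPreconnected_connectedComponentIn (x := x) (F := H) (ball x r) {x}ᶜ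
        isOpen_ball isOpen_compl_singleton
        (by
          intro w _
          by_cases h : w = x
          · left; rw [h]; exact mem_ball_self hr
          · right; exact h)
        ⟨x, mem_connectedComponentIn hx, mem_ball_self hr⟩ ⟨y, hy, hyx⟩
      have : w ∈ ball x r ∩ H := ⟨hw1, connectedComponentIn_subset H x hw⟩
      rw [hb] at this
      exact hw2 this
    · simpa using mem_connectedComponentIn hx
  · intro hcc
    let φ : EuclideanSpace ℝ (Fin n) ≃ₜ (Fin n → ℝ) :=
      (EuclideanSpace.equiv (Fin n) ℝ).toHomeomorph
    have hφ : ∀ y, φ y = (y : Fin n → ℝ) := fun y => rfl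
    have h1 := φ.image_connectedComponentIn hx
    rw [hcc, Set.image_singleton] at h1
    obtain ⟨U, hU, hxU, hUH⟩ := aux_main f (φ '' H) (by
      ext y
      constructor
      · rintro ⟨w, hw, rfl⟩
        rw [hH] at hw
        exact hw
      · intro hy
        refine ⟨φ.symm y, ?_, φ.apply_symm_apply y⟩
        rw [hH, Set.mem_setOf_eq, ← hφ, φ.apply_symm_apply]
        exact hy) (φ x) ⟨x, hx, rfl⟩ h1.symm
    obtain ⟨r, hr, hrU⟩ := Metric.isOpen_iff.1 (hU.preimage φ.continuous) x hxU
    refine ⟨r, hr, Set.Subset.antisymm ?_ ?_⟩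
    · rintro y ⟨hy, hyH⟩
      exact φ.injective (hUH _ (hrU hy) ⟨y, hyH, rfl⟩)
    · rintro _ rfl
      exact ⟨mem_ball_self hr, hx⟩
end

section
/- Let f be a polynomial in ℝ[x₁,…,xₙ]. Then the set 𝒵(f) of isolated points of H(f) is finite. -/
open MvPolynomial Metric

lemma iso_alg {n : ℕ} (I : Ideal (MvPolynomial (Fin n) ℝ)) [I.IsPrime] :
    (∀ i, ∃ p : Polynomial ℝ, p ≠ 0 ∧ Polynomial.aeval (X i : MvPolynomial (Fin n) ℝ) p ∈ I) ∨
    ∃ D : Derivation ℝ (MvPolynomial (Fin n) ℝ) (MvPolynomial (Fin n) ℝ),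
      (∀ h ∈ I, D h ∈ I) ∧ ∃ i, D (X i) ∉ I := by
  let A := MvPolynomial (Fin n) ℝ ⧸ I
  let K := FractionRing A
  let π : MvPolynomial (Fin n) ℝ →ₐ[ℝ] K :=
    (IsScalarTower.toAlgHom ℝ A K).comp (Ideal.Quotient.mkₐ ℝ I)
  have hπ : ∀ h, π h = 0 ↔ h ∈ I := by
    intro h
    change algebraMap A K (Ideal.Quotient.mk I h) = 0 ↔ _
    rw [FaithfulSMul.algebraMap_eq_zero_iff, Ideal.Quotient.eq_zero_iff_mem]
  have hess : Algebra.EssFiniteType ℝ K := inferInstance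
  by_cases hs : Subsingleton (Ω[K⁄ℝ])
  · left
    have : Algebra.FormallyUnramified ℝ K := ⟨hs⟩
    have : Module.Finite ℝ K := Algebra.FormallyUnramified.finite_of_free ℝ K
    intro i
    have hint : IsAlgebraic ℝ (π (X i)) := Algebra.IsAlgebraic.isAlgebraic _
    obtain ⟨p, hp, hp'⟩ := hint
    refine ⟨p, hp, ?_⟩
    rw [← hπ, ← hp', Polynomial.aeval_algHom_apply]
  · right
    rw [not_subsingleton_iff_nontrivial] at hs
    obtain ⟨w, hw⟩ := exists_ne (0 : Ω[K⁄ℝ])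
    obtain ⟨φ, hφ⟩ : ∃ φ : Module.Dual K (Ω[K⁄ℝ]), φ w ≠ 0 := by
      by_contra! hcon
      exact hw ((Module.forall_dual_apply_eq_zero_iff K w).1 hcon)
    let d : Derivation ℝ K K := φ.compDer (KaehlerDifferential.D ℝ K)
    have hd : ∃ i, d (π (X i)) ≠ 0 := by
      by_contra! hcon
      have h1 : ∀ h, d (π h) = 0 := by
        intro h
        induction h using MvPolynomial.induction_on with
        | C a =>
          have : π (C a) = algebraMap ℝ K a := π.commutes a
          rw [this, Derivation.map_algebraMap]
        | add p q hp hq => rw [map_add, map_add, hp, hq, add_zero]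
        | mul_X p i hp => rw [map_mul, Derivation.leibniz, hp, hcon, smul_zero, smul_zero, add_zero]
      have h2 : ∀ k, d k = 0 := by
        intro k
        obtain ⟨a, b, hb, rfl⟩ := IsFractionRing.div_surjective (A := A) k
        obtain ⟨a, rfl⟩ := Ideal.Quotient.mk_surjective a
        obtain ⟨b, rfl⟩ := Ideal.Quotient.mk_surjective b
        have ha : d (algebraMap A K (Ideal.Quotient.mk I a)) = 0 := h1 a
        have hb : d (algebraMap A K (Ideal.Quotient.mk I b)) = 0 := h1 b
        rw [Derivation.leibniz_div, ha, hb]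
        simp
      have h3 : φ = 0 := by
        apply LinearMap.ext_on_range (KaehlerDifferential.span_range_derivation ℝ K)
        intro k
        exact h2 k
      exact hφ (by rw [h3]; rfl)
    obtain ⟨b, hb⟩ := IsLocalization.exist_integer_multiples_of_finite (nonZeroDivisors A)
      (fun i => d (π (X i)))
    have hb0 : algebraMap A K b ≠ 0 := IsFractionRing.to_map_ne_zero_of_mem_nonZeroDivisors b.2
    have hb' : ∀ i, ∃ p : MvPolynomial (Fin n) ℝ, π p = algebraMap A K b * d (π (X i)) := by
      intro i
      obtain ⟨a, ha⟩ := hb i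
      obtain ⟨a, rfl⟩ := Ideal.Quotient.mk_surjective a
      refine ⟨a, ?_⟩
      rw [← Algebra.smul_def]
      exact ha
    choose p hp using hb'
    let D := mkDerivation ℝ p
    have hD : ∀ h, π (D h) = algebraMap A K b * d (π h) := by
      intro h
      induction h using MvPolynomial.induction_on with
      | C a =>
        have : π (C a) = algebraMap ℝ K a := π.commutes a
        have h2 : D (C a) = 0 := D.map_algebraMap a
        rw [this, Derivation.map_algebraMap, h2, map_zero, mul_zero]
      | add p q hp hq => rw [map_add, map_add, hp, hq, map_add, map_add, mul_add]
      | mul_X q i hq =>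
        rw [Derivation.leibniz, map_add, smul_eq_mul, smul_eq_mul, map_mul, map_mul, hq,
          mkDerivation_X, hp, map_mul, Derivation.leibniz, smul_eq_mul, smul_eq_mul]
        ring
    refine ⟨D, ?_, ?_⟩
    · intro h hh
      rw [← hπ, hD, (hπ h).2 hh, map_zero, mul_zero]
    · obtain ⟨i, hi⟩ := hd
      refine ⟨i, ?_⟩
      rw [← hπ, hD]
      exact mul_ne_zero hb0 hi

lemma iso_ode {n : ℕ} (I : Ideal (MvPolynomial (Fin n) ℝ))
    (D : Derivation ℝ (MvPolynomial (Fin n) ℝ) (MvPolynomial (Fin n) ℝ))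
    (hD : ∀ h ∈ I, D h ∈ I) (x : Fin n → ℝ) (hx : ∀ h ∈ I, eval x h = 0)
    (i : Fin n) (hi : eval x (D (X i)) ≠ 0)
    (hiso : ∀ᶠ y in nhds x, (∀ h ∈ I, eval y h = 0) → y = x) : False := by
  let F : (Fin n → ℝ) → (Fin n → ℝ) := fun y j => eval y (D (X j))
  have hF : ContDiffAt ℝ 1 F x := by
    rw [contDiffAt_pi]
    intro j
    exact (AnalyticOnNhd.eval_mvPolynomial (D (X j)) x (Set.mem_univ _)).contDiffAt
  obtain ⟨γ, hγ0, ε, hε, hγ⟩ :=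
    hF.exists_forall_mem_closedBall_exists_eq_forall_mem_Ioo_hasDerivAt₀ 0
  simp only [zero_sub, zero_add] at hγ
  have hder : ∀ t ∈ Set.Ioo (-ε) ε, ∀ h, HasDerivAt (fun s => eval (γ s) h)
      (eval (γ t) (D h)) t := by
    intro t ht h
    induction h using MvPolynomial.induction_on with
    | C a =>
      have : D (C a) = 0 := D.map_algebraMap a
      rw [this]
      simpa using hasDerivAt_const t a
    | add p q hp hq => 
      simp only [map_add]
      exact hp.add hq
    | mul_X p j hp =>
      have h1 := hasDerivAt_pi.1 (hγ t ht) j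
      have h2 := hp.mul h1
      simp only [map_mul, eval_X, Derivation.leibniz, smul_eq_mul, map_add]
      have h3 : eval (γ t) p * eval (γ t) (D (X j)) + γ t j * eval (γ t) (D p) =
          eval (γ t) (D p) * γ t j + eval (γ t) p * F (γ t) j := by
        simp only [F]
        ring
      rw [h3]
      exact h2
  obtain ⟨s, hs⟩ : I.FG := IsNoetherian.noetherian I
  have hsI : ∀ h ∈ s, h ∈ I := fun h hh => hs ▸ Ideal.subset_span hh
  have hcoef : ∀ h : s, ∃ a : MvPolynomial (Fin n) ℝ → MvPolynomial (Fin n) ℝ,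
      ∑ g ∈ s, a g * g = D h := by
    intro h
    have : D h ∈ Submodule.span (MvPolynomial (Fin n) ℝ) (s : Set (MvPolynomial (Fin n) ℝ)) := by
      change D h ∈ Ideal.span _
      rw [hs]; exact hD _ (hsI _ h.2)
    obtain ⟨a, -, ha⟩ := Submodule.mem_span_finset.1 this
    exact ⟨a, ha⟩
  choose a ha using hcoef
  let u : ℝ → (s → ℝ) := fun t h => eval (γ t) h.1
  let u' : ℝ → (s → ℝ) := fun t h => eval (γ t) (D h.1)
  have hsub : Set.Icc 0 (ε/2) ⊆ Set.Ioo (-ε) ε := by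
    intro t ht
    constructor <;> linarith [ht.1, ht.2]
  have hu' : ∀ t ∈ Set.Icc 0 (ε/2), HasDerivAt u (u' t) t := by
    intro t ht
    rw [hasDerivAt_pi]
    intro h
    exact hder t (hsub ht) h
  have hγc : ContinuousOn γ (Set.Icc 0 (ε/2)) := fun t ht =>
    (hγ t (hsub ht)).continuousAt.continuousWithinAt
  have hC : ∀ (h g : s), ∃ C : ℝ, ∀ t ∈ Set.Icc 0 (ε/2), ‖eval (γ t) (a h g)‖ ≤ C := by
    intro h g
    exact isCompact_Icc.exists_bound_of_continuousOn
      ((MvPolynomial.continuous_eval (a h g)).comp_continuousOn hγc)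
  choose C hC using hC
  have h0mem : (0:ℝ) ∈ Set.Icc 0 (ε/2) := ⟨le_rfl, by linarith⟩
  have hC0 : ∀ h g, 0 ≤ C h g := fun h g => (norm_nonneg _).trans (hC h g 0 h0mem)
  have hu0 : ∀ t ∈ Set.Icc 0 (ε/2), u t = 0 := by
    apply eq_zero_of_abs_deriv_le_mul_abs_self_of_eq_zero_right (f' := u')
      (K := ∑ h, ∑ g, C h g)
    · exact fun t ht => (hu' t ht).continuousAt.continuousWithinAt
    · exact fun t ht => (hu' t ⟨ht.1, ht.2.le⟩).hasDerivWithinAt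
    · ext h
      simp only [u, hγ0]
      exact hx _ (hsI _ h.2)
    · intro t ht
      have ht' : t ∈ Set.Icc 0 (ε/2) := ⟨ht.1, ht.2.le⟩
      rw [pi_norm_le_iff_of_nonneg (mul_nonneg (Finset.sum_nonneg fun h _ =>
        Finset.sum_nonneg fun g _ => hC0 h g) (norm_nonneg _))]
      intro h
      have e : u' t h = ∑ g : s, eval (γ t) (a h g) * u t g := by
        simp only [u', u]
        rw [← ha h, map_sum, ← Finset.sum_coe_sort s]
        simp
      rw [e]
      calc ‖∑ g : s, eval (γ t) (a h g) * u t g‖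
          ≤ ∑ g : s, ‖eval (γ t) (a h g) * u t g‖ := norm_sum_le _ _
        _ ≤ ∑ g : s, C h g * ‖u t‖ := by
            apply Finset.sum_le_sum
            intro g _
            rw [norm_mul]
            exact mul_le_mul (hC h g t ht') (norm_le_pi_norm _ _) (norm_nonneg _) (hC0 _ _)
        _ = (∑ g : s, C h g) * ‖u t‖ := by rw [Finset.sum_mul]
        _ ≤ _ := by
            apply mul_le_mul_of_nonneg_right _ (norm_nonneg _)
            exact Finset.single_le_sum (f := fun h => ∑ g, C h g)
              (fun h _ => Finset.sum_nonneg fun g _ => hC0 h g) (Finset.mem_univ h)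
  have hV : ∀ t ∈ Set.Icc 0 (ε/2), ∀ h ∈ I, eval (γ t) h = 0 := by
    intro t ht h hh
    have : I ≤ RingHom.ker (eval (γ t)) := by
      rw [← hs]
      refine Ideal.span_le.2 ?_
      intro g hg
      exact congrFun (hu0 t ht) ⟨g, hg⟩
    exact this hh
  have hmem0 : (0:ℝ) ∈ Set.Ioo (-ε) ε := ⟨by linarith, hε⟩
  have hcont : Filter.Tendsto γ (nhds 0) (nhds x) := by
    have := (hγ 0 hmem0).continuousAt
    rwa [ContinuousAt, hγ0] at this
  have hev : ∀ᶠ t in nhdsWithin (0:ℝ) (Set.Ici 0), γ t = x := by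
    have h1 := (hcont.eventually hiso).filter_mono (nhdsWithin_le_nhds (s := Set.Ici (0:ℝ)))
    have h2 : Set.Icc 0 (ε/2) ∈ nhdsWithin (0:ℝ) (Set.Ici 0) := Icc_mem_nhdsGE (by linarith)
    filter_upwards [h1, h2] with t ht1 ht2
    exact ht1 (hV t ht2)
  have hd1 : HasDerivWithinAt γ (F x) (Set.Ici 0) 0 := by
    have := (hγ 0 hmem0).hasDerivWithinAt (s := Set.Ici 0)
    rwa [hγ0] at this
  have hd2 : HasDerivWithinAt γ 0 (Set.Ici 0) 0 :=
    (hasDerivWithinAt_const (0:ℝ) (Set.Ici 0) x).congr_of_eventuallyEq hev hγ0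
  have heq : F x = 0 := (uniqueDiffOn_Ici (0:ℝ) 0 Set.self_mem_Ici).eq_deriv _ hd1 hd2
  exact hi (congrFun heq i)

lemma iso_main {n : ℕ} (f : MvPolynomial (Fin n) ℝ) (S : Set (Fin n → ℝ))
    (hS : ∀ x ∈ S, eval x f = 0 ∧ ∀ᶠ y in nhds x, eval y f = 0 → y = x) : S.Finite := by
  by_contra hinf
  obtain ⟨I, ⟨T, hTS, hT, rfl⟩, hmax⟩ := set_has_maximal_iff_noetherian.2
    (inferInstance : IsNoetherian (MvPolynomial (Fin n) ℝ) (MvPolynomial (Fin n) ℝ))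
    {I | ∃ T ⊆ S, T.Infinite ∧ I = vanishingIdeal ℝ T} ⟨_, S, le_rfl, hinf, rfl⟩
  have key : ∀ p, (T ∩ {x | eval x p = 0}).Infinite → p ∈ vanishingIdeal ℝ T := by
    intro p hp
    have hle : vanishingIdeal ℝ T ≤ vanishingIdeal ℝ (T ∩ {x | eval x p = 0}) :=
      vanishingIdeal_anti_mono Set.inter_subset_left
    have := hmax _ ⟨_, Set.inter_subset_left.trans hTS, hp, rfl⟩
    have heq := eq_of_le_of_not_lt hle this
    rw [heq]
    intro x hx
    simpa [aeval_eq_eval] using hx.2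
  have hprime : (vanishingIdeal ℝ T).IsPrime := by
    rw [Ideal.isPrime_iff]
    constructor
    · rw [Ideal.ne_top_iff_one]
      intro h1
      obtain ⟨x, hx⟩ := hT.nonempty
      simpa using h1 x hx
    · intro p q hpq
      by_contra! hcon
      have hp := mt (key p) hcon.1
      have hq := mt (key q) hcon.2
      rw [Set.not_infinite] at hp hq
      refine hT ((hp.union hq).subset ?_)
      intro x hx
      have := hpq x hx
      rw [map_mul, mul_eq_zero] at this
      simp only [aeval_eq_eval] at this
      rcases this with h | h
      · exact Or.inl ⟨hx, h⟩
      · exact Or.inr ⟨hx, h⟩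
  rcases iso_alg (vanishingIdeal ℝ T) with h | ⟨D, hD, i, hi⟩
  · choose p hp0 hp using h
    refine hT ((Set.Finite.pi' (t := fun i => {r | r ∈ (p i).roots.toFinset})
      (fun i => Finset.finite_toSet _)).subset ?_)
    intro x hx i
    have := hp i x hx
    rw [← Polynomial.aeval_algHom_apply, aeval_X] at this
    simpa [hp0 i, Polynomial.IsRoot] using this
  · have : ∃ x ∈ T, eval x (D (X i)) ≠ 0 := by
      by_contra! hcon
      exact hi fun x hx => by simpa [aeval_eq_eval] using hcon x hx
    obtain ⟨x, hxT, hx⟩ := this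
    refine iso_ode (vanishingIdeal ℝ T) D hD x ?_ i hx ?_
    · intro h hh
      simpa [aeval_eq_eval] using hh x hxT
    · filter_upwards [(hS x (hTS hxT)).2] with y hy h
      refine hy (h f ?_)
      intro z hz
      simpa [aeval_eq_eval] using (hS z (hTS hz)).1

/-- The set `𝒵(f)` of isolated points of the real zero set
`H(f) = {x ∈ ℝⁿ | f(x) = 0}` of a polynomial `f ∈ ℝ[x₁,…,xₙ]` is finite. -/
theorem isolatedPoints_finite
    (n : ℕ) (hn : 1 ≤ n) (f : MvPolynomial (Fin n) ℝ)
    (H : Set (EuclideanSpace ℝ (Fin n)))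
    (hH : H = {y : EuclideanSpace ℝ (Fin n) | MvPolynomial.eval y f = 0}) :
    Set.Finite {x : EuclideanSpace ℝ (Fin n) |
      x ∈ H ∧ ∃ r > 0, Metric.ball x r ∩ H = {x}} := by
  subst hH
  let e := EuclideanSpace.equiv (Fin n) ℝ
  refine Set.Finite.of_finite_image (f := e) ?_ e.injective.injOn
  apply iso_main f
  rintro _ ⟨x, ⟨hx, r, hr, hball⟩, rfl⟩
  refine ⟨hx, ?_⟩
  have h1 : ∀ᶠ z in nhds x, eval (e z) f = 0 → z = x := by
    filter_upwards [Metric.ball_mem_nhds x hr] with z hz hz0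
    have : z ∈ Metric.ball x r ∩ {y : EuclideanSpace ℝ (Fin n) | MvPolynomial.eval y f = 0} :=
      ⟨hz, hz0⟩
    rwa [hball] at this
  have h2 : Filter.Tendsto e.symm (nhds (e x)) (nhds x) := by
    simpa using e.symm.continuous.tendsto (e x)
  filter_upwards [h2.eventually h1] with y hy hy0
  have := hy (by simpa using hy0)
  rw [← this]; simp
end

section
/- Let f be a polynomial in ℝ[x₁,…,xₙ] and let ρ > 0 satisfy ‖x‖ < ρ for every x ∈ 𝒵(f). Let 𝒵'(V) denote the set of points p = (x,s) ∈ V with s ≠ 0 that are isolated points of V (i.e. there is r > 0 with B(p,r) ∩ V = {p} in ℝ^{n+1}). Then the image of 𝒵'(V) under the projection π : (x,s) ↦ x equals 𝒵(f). -/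
open MvPolynomial Metric

/-- `ℝ^{n+1}` identified with `ℝⁿ × ℝ`, equipped with the Euclidean (L²) norm. -/
noncomputable abbrev EuclProd (n : ℕ) : Type :=
  WithLp 2 (EuclideanSpace ℝ (Fin n) × ℝ)

/-- The `ℝⁿ`-component of a point of `ℝⁿ × ℝ`. -/
noncomputable def xpart {n : ℕ} (p : EuclProd n) : EuclideanSpace ℝ (Fin n) :=
  (WithLp.equiv 2 (EuclideanSpace ℝ (Fin n) × ℝ) p).1

/-- The last (`ℝ`-)component of a point of `ℝⁿ × ℝ`. -/
def spart {n : ℕ} (p : EuclProd n) : ℝ :=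
  (WithLp.equiv 2 (EuclideanSpace ℝ (Fin n) × ℝ) p).2

theorem isol_iff {X : Type*} [PseudoMetricSpace X] (S : Set X) (p : X) (hp : p ∈ S) :
    (∃ r > 0, Metric.ball p r ∩ S = {p}) ↔ ∀ᶠ q in nhds p, q ∈ S → q = p := by
  rw [Metric.eventually_nhds_iff_ball]
  constructor
  · rintro ⟨r, hr, h⟩
    refine ⟨r, hr, fun q hq hS => ?_⟩
    have : q ∈ Metric.ball p r ∩ S := ⟨hq, hS⟩
    rw [h] at this
    exact this
  · rintro ⟨r, hr, h⟩
    refine ⟨r, hr, Set.eq_singleton_iff_unique_mem.2 ⟨⟨Metric.mem_ball_self hr, hp⟩, ?_⟩⟩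
    rintro q ⟨hq, hS⟩
    exact h q hq hS

theorem xpart_cont {n : ℕ} : Continuous (xpart (n := n)) :=
  continuous_fst.comp (WithLp.prod_continuous_ofLp 2 _ _)

theorem spart_cont {n : ℕ} : Continuous (spart (n := n)) :=
  continuous_snd.comp (WithLp.prod_continuous_ofLp 2 _ _)

theorem eucl_ext {n : ℕ} {p q : EuclProd n} (h1 : xpart p = xpart q) (h2 : spart p = spart q) :
    p = q :=
  (WithLp.equiv 2 (EuclideanSpace ℝ (Fin n) × ℝ)).injective (Prod.ext h1 h2)

/-- Let `ρ > 0` be larger than the norm of every isolated point of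
`H(f)`, and let `V = {(x,s) ∈ ℝⁿ × ℝ | f(x) = 0, ‖x‖² + s² = ρ²}`.  Then the image
under `π : (x,s) ↦ x` of the set of isolated points of `V` with nonzero last
coordinate is exactly the set `𝒵(f)` of isolated points of `H(f)`. -/
theorem proj_isolated_sphere_lift_eq_isolated
    (n : ℕ) (hn : 1 ≤ n) (f : MvPolynomial (Fin n) ℝ)
    (H : Set (EuclideanSpace ℝ (Fin n)))
    (hH : H = {y : EuclideanSpace ℝ (Fin n) | MvPolynomial.eval y f = 0})
    (Zf : Set (EuclideanSpace ℝ (Fin n)))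
    (hZf : Zf = {x : EuclideanSpace ℝ (Fin n) |
      x ∈ H ∧ ∃ r > 0, Metric.ball x r ∩ H = {x}})
    (ρ : ℝ) (hρ : 0 < ρ) (hρbig : ∀ x ∈ Zf, ‖x‖ < ρ)
    (V : Set (EuclProd n))
    (hV : V = {p : EuclProd n |
      MvPolynomial.eval (xpart p) f = 0 ∧ ‖xpart p‖ ^ 2 + (spart p) ^ 2 = ρ ^ 2})
    (Z'V : Set (EuclProd n))
    (hZ'V : Z'V = {p : EuclProd n |
      p ∈ V ∧ spart p ≠ 0 ∧ ∃ r > 0, Metric.ball p r ∩ V = {p}}) :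
    xpart '' Z'V = Zf := by
  ext x
  constructor
  · rintro ⟨p, hp, rfl⟩
    rw [hZ'V] at hp
    obtain ⟨hpV, hs, hiso⟩ := hp
    rw [isol_iff V p hpV] at hiso
    have hpV2 := hpV
    rw [hV] at hpV2
    obtain ⟨hf, hn2⟩ := hpV2
    have hxH : xpart p ∈ H := by rw [hH]; exact hf
    rw [hZf]
    refine ⟨hxH, (isol_iff H _ hxH).2 ?_⟩
    let c : ℝ := spart p / |spart p|
    have hc : c ^ 2 = 1 := by
      simp only [c, div_pow, sq_abs]
      exact div_self (pow_ne_zero 2 hs)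
    let g : EuclideanSpace ℝ (Fin n) → EuclProd n :=
      fun y => WithLp.toLp 2 (y, c * Real.sqrt (ρ ^ 2 - ‖y‖ ^ 2))
    have hg : Continuous g :=
      (WithLp.prod_continuous_toLp 2 _ _).comp (by fun_prop)
    have hgx : ∀ y, xpart (g y) = y := fun y => rfl
    have hgs : ∀ y, spart (g y) = c * Real.sqrt (ρ ^ 2 - ‖y‖ ^ 2) := fun y => rfl
    have hgp : g (xpart p) = p := by
      refine eucl_ext (hgx _) ?_
      rw [hgs, ← hn2, add_sub_cancel_left, Real.sqrt_sq_eq_abs]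
      exact div_mul_cancel₀ _ (abs_ne_zero.2 hs)
    have h1 : ∀ᶠ y in nhds (xpart p), g y ∈ V → g y = p := by
      have := hg.tendsto (xpart p)
      rw [hgp] at this
      exact this.eventually hiso
    have h2 : ∀ᶠ y in nhds (xpart p), ‖y‖ ^ 2 < ρ ^ 2 := by
      have hcont : Continuous fun y : EuclideanSpace ℝ (Fin n) => ‖y‖ ^ 2 := by fun_prop
      refine (hcont.tendsto (xpart p)).eventually (gt_mem_nhds ?_)
      have := pow_pos (abs_pos.2 hs) 2
      rw [sq_abs] at this
      linarith
    filter_upwards [h1, h2] with y hy1 hy2 hyH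
    have hgV : g y ∈ V := by
      rw [hV]
      rw [hH] at hyH
      refine ⟨hyH, ?_⟩
      rw [hgx, hgs, mul_pow, hc, Real.sq_sqrt (by linarith)]
      ring
    rw [← hy1 hgV, hgx]
  · intro hx
    have hlt := hρbig x hx
    rw [hZf] at hx
    obtain ⟨hxH, hiso⟩ := hx
    rw [isol_iff H x hxH] at hiso
    have hpos : 0 < ρ ^ 2 - ‖x‖ ^ 2 := by
      have := norm_nonneg x
      nlinarith
    let p : EuclProd n := WithLp.toLp 2 (x, Real.sqrt (ρ ^ 2 - ‖x‖ ^ 2))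
    have hpx : xpart p = x := rfl
    have hps : spart p = Real.sqrt (ρ ^ 2 - ‖x‖ ^ 2) := rfl
    have hspos : 0 < spart p := by rw [hps]; exact Real.sqrt_pos.2 hpos
    have hpV : p ∈ V := by
      rw [hV]
      rw [hH] at hxH
      refine ⟨hxH, ?_⟩
      rw [hpx, hps, Real.sq_sqrt hpos.le]
      ring
    refine ⟨p, ?_, hpx⟩
    rw [hZ'V]
    refine ⟨hpV, hspos.ne', (isol_iff V p hpV).2 ?_⟩
    have h1 : ∀ᶠ q in nhds p, xpart q ∈ H → xpart q = x :=
      (xpart_cont.tendsto p).eventually hiso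
    have h2 : ∀ᶠ q in nhds p, 0 < spart q :=
      (spart_cont.tendsto p).eventually (lt_mem_nhds hspos)
    filter_upwards [h1, h2] with q hq1 hq2 hqV
    rw [hV] at hqV hpV
    have hqx : xpart q = x := hq1 (by rw [hH]; exact hqV.1)
    refine eucl_ext hqx ?_
    have e1 := hqV.2
    have e2 := hpV.2
    rw [hqx] at e1
    rw [hpx] at e2
    exact (pow_left_inj₀ hq2.le hspos.le two_ne_zero).1 (by linarith)
end

section
/- Let ρ > 0 and let x' = (α, a) and y' = (β, b) be points of ℝⁿ × ℝ satisfying ‖α‖² + a² = ρ², ‖β‖² + b² = ρ², a ≠ 0 and a·b ≥ 0. Then ‖y' − x'‖ ≤ (1 + 2ρ/|a|)·‖β − α‖, where the norms are the Euclidean norms on ℝ^{n+1} and ℝⁿ respectively. -/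
open Metric

/-- Build a point of `ℝ^{n+1} = ℝⁿ × ℝ` from its two components. -/
noncomputable def mkPt {n : ℕ} (x : EuclideanSpace ℝ (Fin n)) (s : ℝ) : EuclProd n :=
  (WithLp.equiv 2 (EuclideanSpace ℝ (Fin n) × ℝ)).symm (x, s)

/-- If `x' = (α, a)` and `y' = (β, b)` lie on the sphere
`‖x‖² + s² = ρ²` in `ℝⁿ × ℝ`, with `a ≠ 0` and `a·b ≥ 0`, then
`‖y' − x'‖ ≤ (1 + 2ρ/|a|)·‖β − α‖` (Euclidean norms). -/
theorem sphere_lift_dist_bound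
    (n : ℕ) (ρ : ℝ) (hρ : 0 < ρ)
    (α β : EuclideanSpace ℝ (Fin n)) (a b : ℝ)
    (hx : ‖α‖ ^ 2 + a ^ 2 = ρ ^ 2) (hy : ‖β‖ ^ 2 + b ^ 2 = ρ ^ 2)
    (ha : a ≠ 0) (hab : 0 ≤ a * b) :
    ‖mkPt β b - mkPt α a‖ ≤ (1 + 2 * ρ / |a|) * ‖β - α‖ := by
  have hd := abs_norm_sub_norm_le β α
  have hN : ‖mkPt β b - mkPt α a‖ = Real.sqrt (‖β - α‖ ^ 2 + ‖b - a‖ ^ 2) :=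
    WithLp.prod_norm_eq_of_L2 _
  rw [hN]
  have hd0 := norm_nonneg (β - α)
  have ha' : 0 < |a| := abs_pos.mpr ha
  have h1 : ‖α‖ ≤ ρ := by
    exact abs_le_of_sq_le_sq' (by nlinarith [sq_nonneg a]) hρ.le |>.2
  have h2 : ‖β‖ ≤ ρ := by
    exact abs_le_of_sq_le_sq' (by nlinarith [sq_nonneg b]) hρ.le |>.2
  have hle : |a| ≤ |b + a| := by
    apply sq_le_sq.mp
    nlinarith [sq_nonneg b]
  have key : |b - a| * |a| ≤ 2 * ρ * ‖β - α‖ := by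
    calc |b - a| * |a| ≤ |b - a| * |b + a| := by gcongr
      _ = |(‖β‖ + ‖α‖) * (‖β‖ - ‖α‖)| := by
        rw [← abs_mul, ← abs_neg]; congr 1; linarith
      _ = (‖β‖ + ‖α‖) * |‖β‖ - ‖α‖| := by
        rw [abs_mul, abs_of_nonneg (by positivity)]
      _ ≤ 2 * ρ * ‖β - α‖ := by
        refine mul_le_mul ?_ hd (abs_nonneg _) (by positivity)
        linarith
  have h3 : |b - a| ≤ 2 * ρ / |a| * ‖β - α‖ := by
    rw [div_mul_eq_mul_div, le_div_iff₀ ha']; exact key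
  have h4 : Real.sqrt (‖β - α‖ ^ 2 + ‖b - a‖ ^ 2) ≤ ‖β - α‖ + |b - a| := by
    rw [Real.norm_eq_abs]
    refine Real.sqrt_le_iff.mpr ⟨by positivity, ?_⟩
    nlinarith [mul_nonneg hd0 (abs_nonneg (b - a))]
  linarith
end

section
/- Let f be a polynomial in ℝ[x₁,…,xₙ], ρ > 0, e ∈ ℝ and i ∈ {1,…,n}. Let p = (x,s) ∈ V_e with s ≠ 0, and suppose that p is a point of local extremum (local minimum or local maximum) of the function (y,t) ↦ y_i restricted to the set V_e. Then ∂f/∂x_j(x) = 0 for every j ∈ {1,…,n} with j ≠ i. -/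
open MvPolynomial Metric

/-- The level set `V_e = {(x,s) | f(x) = e, ‖x‖² + s² = ρ²}`. -/
noncomputable def levelV {n : ℕ} (f : MvPolynomial (Fin n) ℝ) (ρ e : ℝ) :
    Set (EuclProd n) :=
  {p : EuclProd n |
    MvPolynomial.eval (xpart p) f = e ∧ ‖xpart p‖ ^ 2 + (spart p) ^ 2 = ρ ^ 2}

noncomputable def Xc {n : ℕ} (k : Fin n) : EuclProd n →L[ℝ] ℝ :=
  (EuclideanSpace.proj k : EuclideanSpace ℝ (Fin n) →L[ℝ] ℝ).comp
    (WithLp.fstL 2 ℝ (EuclideanSpace ℝ (Fin n)) ℝ)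

noncomputable def Sc {n : ℕ} : EuclProd n →L[ℝ] ℝ :=
  WithLp.sndL 2 ℝ (EuclideanSpace ℝ (Fin n)) ℝ

theorem Xc_apply {n : ℕ} (k : Fin n) (q : EuclProd n) : Xc k q = xpart q k := rfl
theorem Sc_apply {n : ℕ} (q : EuclProd n) : Sc q = spart q := rfl

theorem hasStrict_eval {n : ℕ} (f : MvPolynomial (Fin n) ℝ) (p : EuclProd n) :
    HasStrictFDerivAt (fun q : EuclProd n => MvPolynomial.eval (xpart q) f)
      (∑ k, MvPolynomial.eval (xpart p) (MvPolynomial.pderiv k f) • (Xc k : EuclProd n →L[ℝ] ℝ)) p := by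
  induction f using MvPolynomial.induction_on with
  | C a => simpa using hasStrictFDerivAt_const a p
  | add f g hf hg =>
    simp only [map_add, add_smul, Finset.sum_add_distrib]
    exact hf.add hg
  | mul_X f m hf =>
    have h := hf.mul (Xc m : EuclProd n →L[ℝ] ℝ).hasStrictFDerivAt
    simp only [map_mul, eval_X]
    refine h.congr_fderiv ?_
    ext v
    simp [Derivation.leibniz, pderiv_X, Pi.single_apply, add_mul, Finset.sum_add_distrib,
      Xc_apply, Finset.mul_sum, apply_ite, ite_mul]
    exact Finset.sum_congr rfl fun _ _ => by ring

/-- If `p = (x,s) ∈ V_e` with `s ≠ 0` is a local extremum of the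
`i`-th coordinate function `(y,t) ↦ yᵢ` restricted to `V_e`, then all partial
derivatives `∂f/∂x_j(x)` with `j ≠ i` vanish. -/
theorem local_extremum_partials_vanish
    (n : ℕ) (hn : 1 ≤ n) (f : MvPolynomial (Fin n) ℝ)
    (ρ : ℝ) (hρ : 0 < ρ) (e : ℝ) (i : Fin n)
    (p : EuclProd n) (hp : p ∈ levelV f ρ e) (hs : spart p ≠ 0)
    (hext :
      (∃ r > 0, ∀ q ∈ levelV f ρ e ∩ Metric.ball p r, xpart q i ≤ xpart p i) ∨
      (∃ r > 0, ∀ q ∈ levelV f ρ e ∩ Metric.ball p r, xpart p i ≤ xpart q i)) :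
    ∀ j : Fin n, j ≠ i →
      MvPolynomial.eval (xpart p) (MvPolynomial.pderiv j f) = 0 := by
  classical
  intro j hj
  have hg : ∀ q : EuclProd n, ‖xpart q‖ ^ 2 + spart q ^ 2 = ∑ k, Xc k q ^ 2 + Sc q ^ 2 := by
    intro q
    rw [EuclideanSpace.norm_sq_eq]
    simp [Xc_apply, Sc_apply]
  have hX : ∀ (T : EuclProd n →L[ℝ] ℝ), HasStrictFDerivAt (fun q => T q ^ 2) ((2 * T p) • T) p := by
    intro T
    have h := T.hasStrictFDerivAt (x := p)
    refine (h.pow 2).congr_fderiv ?_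
    ext v
    simp
  have hG : HasStrictFDerivAt (fun q : EuclProd n => ‖xpart q‖ ^ 2 + spart q ^ 2)
      (∑ k, (2 * Xc k p) • (Xc k : EuclProd n →L[ℝ] ℝ) + (2 * Sc p) • Sc) p := by
    simp only [hg]
    exact (HasStrictFDerivAt.fun_sum fun k _ => hX (Xc k)).add (hX Sc)
  have hF := hasStrict_eval f p
  have hset : {q : EuclProd n | (fun q : EuclProd n => (MvPolynomial.eval (xpart q) f,
      ‖xpart q‖ ^ 2 + spart q ^ 2)) q = (fun q : EuclProd n => (MvPolynomial.eval (xpart q) f,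
      ‖xpart q‖ ^ 2 + spart q ^ 2)) p} = levelV f ρ e := by
    ext q
    simp only [levelV, Set.mem_ofPred_eq, Prod.mk.injEq, hp.1, hp.2]
  have hE : IsLocalExtrOn (fun q => (Xc i : EuclProd n →L[ℝ] ℝ) q) (levelV f ρ e) p := by
    rcases hext with ⟨r, hr, h⟩ | ⟨r, hr, h⟩
    · right
      filter_upwards [inter_mem_nhdsWithin _ (Metric.ball_mem_nhds p hr)] with q hq using h q hq
    · left
      filter_upwards [inter_mem_nhdsWithin _ (Metric.ball_mem_nhds p hr)] with q hq using h q hq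
  rw [← hset] at hE
  obtain ⟨L, c, hne, hL⟩ := hE.exists_linear_map_of_hasStrictFDerivAt (hF.prodMk hG)
    (Xc i : EuclProd n →L[ℝ] ℝ).hasStrictFDerivAt
  obtain ⟨a, b, hLe⟩ : ∃ a b : ℝ, ∀ u v : ℝ, L (u, v) = u * a + v * b := by
    refine ⟨L (1, 0), L (0, 1), fun u v => ?_⟩
    have : ((u, v) : ℝ × ℝ) = u • ((1, 0) : ℝ × ℝ) + v • ((0, 1) : ℝ × ℝ) := by simp
    rw [this, map_add, map_smul, map_smul]
    simp
  have hXx : ∀ k m : Fin n, Xc k (WithLp.toLp 2 (EuclideanSpace.single m (1:ℝ), (0:ℝ)) : EuclProd n)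
      = if k = m then 1 else 0 := by
    intro k m
    simp [Xc_apply, xpart]
  have hSx : ∀ m : Fin n, Sc (WithLp.toLp 2 (EuclideanSpace.single m (1:ℝ), (0:ℝ)) : EuclProd n)
      = 0 := fun m => by simp [Sc_apply, spart]
  have hXs : ∀ k : Fin n, Xc k (WithLp.toLp 2 (0, (1:ℝ)) : EuclProd n) = 0 := by
    intro k
    simp [Xc_apply, xpart]
  have hSs : Sc (WithLp.toLp 2 (0, (1:ℝ)) : EuclProd n) = 1 := by simp [Sc_apply, spart]
  have h1 := hL (WithLp.toLp 2 (0, (1:ℝ)) : EuclProd n)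
  have h2 : ∀ m, _ := fun m : Fin n =>
    hL (WithLp.toLp 2 (EuclideanSpace.single m (1:ℝ), (0:ℝ)) : EuclProd n)
  simp [hXs, hSs] at h1
  rw [hLe] at h1
  have hb : b = 0 := by simpa [Sc_apply, hs] using h1
  simp only [ContinuousLinearMap.prod_apply, _root_.add_apply,
    _root_.sum_apply, _root_.smul_apply, hXx, hSx, hLe, hb] at h2
  have hj2 := h2 j
  have hi2 := h2 i
  simp [hj.symm] at hj2 hi2
  rcases hj2 with h | h
  · exact h
  · exfalso
    apply hne
    have hc : c = 0 := by simpa [h] using hi2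
    have hL0 : L = 0 := by
      refine LinearMap.ext fun w => ?_
      rw [← Prod.mk.eta (p := w), hLe, h, hb]
      simp
    rw [hc, hL0]
    rfl
end
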